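/- Let T : X → X be the moving-head action of the decorated SMART machine. Then (1) T has infinite order: T^n ≠ id for every n ≥ 1; and (2) there exist constants C, C' > 0 such that the movement function of the decorated SMART machine satisfies m(n) ≤ C·log n + C' for all n ≥ 1. -/

import Mathlib

/-! ### Turing machine symbols and local step functions -/

/-- Tape/head symbols: a plain tape letter, or a head `(q, a)` on top of letter `a`. -/
abbrev TSym (Q Γ : Type) : Type := Γ ⊕ (Q × Γ)

/-- The tape letter carried by a cell (under the head if the cell carries the head). -/
def tapeLetter {Q Γ : Type} : TSym Q Γ → Γ
  | Sum.inl a => a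
  | Sum.inr (_, a) => a

/-- A complete deterministic machine is given by a head-step function: at `(q, a)` it either
rewrites the head in place (`.inl (q', b)`, a matching transition), or moves in direction
`δ ∈ {+1, -1}` into state `q'` (`.inr (δ, q')`, a move transition). -/
abbrev HeadStep (Q Γ : Type) : Type := Q → Γ → ((Q × Γ) ⊕ (ℤ × Q))

/-- If the symbol `s` carries a head about to move in direction `d`, the state in which the
head arrives; `none` otherwise. -/
def arrivesAs {Q Γ : Type} (δ : HeadStep Q Γ) (s : TSym Q Γ) (d : ℤ) : Option Q :=
  match s with
  | Sum.inl _ => none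
  | Sum.inr (q, a) =>
    match δ q a with
    | Sum.inl _ => none
    | Sum.inr (d', q') => if d' = d then some q' else none

/-- The local rule of the moving-head dynamics: the new symbol of a cell, given the symbols
`l, c, r` of its left neighbour, itself, and its right neighbour. -/
def localStep {Q Γ : Type} (δ : HeadStep Q Γ) (l c r : TSym Q Γ) : TSym Q Γ :=
  match c with
  | Sum.inr (q, a) =>
    (match δ q a with
     | Sum.inl qb => Sum.inr qb
     | Sum.inr _ => Sum.inl a)
  | Sum.inl a =>
    (match arrivesAs δ l 1 with
     | some q' => Sum.inr (q', a)
     | none =>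
       match arrivesAs δ r (-1) with
       | some q' => Sum.inr (q', a)
       | none => Sum.inl a)

/-- The moving-head action of a complete deterministic machine on bi-infinite tapes. -/
def stepZ {Q Γ : Type} (δ : HeadStep Q Γ) (x : ℤ → TSym Q Γ) : ℤ → TSym Q Γ :=
  fun i => localStep δ (x (i - 1)) (x i) (x (i + 1))

/-- The action of a complete deterministic machine on cyclic tapes of length `ℓ`. -/
def stepC {Q Γ : Type} (δ : HeadStep Q Γ) (ℓ : ℕ) (w : ZMod ℓ → TSym Q Γ) :
    ZMod ℓ → TSym Q Γ :=
  fun i => localStep δ (w (i - 1)) (w i) (w (i + 1))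

/-- A configuration has at most one head. -/
def AtMostOneHeadZ {Q Γ : Type} (x : ℤ → TSym Q Γ) : Prop :=
  ∀ i j : ℤ, (x i).isRight = true → (x j).isRight = true → i = j

/-- A cyclic configuration has at most one head. -/
def AtMostOneHeadC {Q Γ : Type} {ℓ : ℕ} (w : ZMod ℓ → TSym Q Γ) : Prop :=
  ∀ i j : ZMod ℓ, (w i).isRight = true → (w j).isRight = true → i = j

/-! ### The SMART machine -/

/-- The four arrows `▶, ◀, ▷, ◁` (filled right/left, hollow right/left). -/
inductive Arrow : Type
  | rf  -- ▶ (filled right)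
  | lf  -- ◀ (filled left)
  | rh  -- ▷ (hollow right)
  | lh  -- ◁ (hollow left)
deriving DecidableEq

/-- The SMART state set `Q̊`: an arrow with a subscript in `{1,2}`; the subscript `b`
is represented by the `Fin 2` value `b - 1`. -/
abbrev SQ : Type := Arrow × Fin 2

/-- The SMART tape alphabet `{0,1,2}`. -/
abbrev Letter : Type := Fin 3

/-- The head-step function of the SMART machine.  States `q₂` (second component `1`) are
move states; states `q₁` (second component `0`) are matching states. -/
def smartStep : HeadStep SQ Letter := fun q a =>
  if q.2 = 1 then
    match q.1 with
    | .rf => Sum.inr (1, (.rf, 0))   -- (▶₂, +1, ▶₁)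
    | .lf => Sum.inr (-1, (.lf, 0))  -- (◀₂, −1, ◀₁)
    | .rh => Sum.inr (1, (.rh, 0))   -- (▷₂, +1, ▷₁)
    | .lh => Sum.inr (-1, (.lh, 0))  -- (◁₂, −1, ◁₁)
  else
    match q.1 with
    | .rf => Sum.inl (if a = 0 then ((.lf, 1), 1) else if a = 1 then ((.lh, 1), 1) else ((.lh, 1), 2))
    | .lf => Sum.inl (if a = 0 then ((.rf, 1), 1) else if a = 1 then ((.rh, 1), 1) else ((.rh, 1), 2))
    | .rh => Sum.inl (if a = 0 then ((.rf, 1), 2) else if a = 1 then ((.rf, 1), 0) else ((.lh, 1), 0))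
    | .lh => Sum.inl (if a = 0 then ((.lf, 1), 2) else if a = 1 then ((.lf, 1), 0) else ((.rh, 1), 0))

/-! ### The decorated SMART machine -/

/-- The state set of the decorated SMART machine: a SMART state together with a *duck*
`d ∈ {d₀, d₁}` (as `Fin 2`, `0 ↦ d₀`) and a *ghost* `x ∈ {0,…,5}` (as `Fin 6`). -/
abbrev DQ : Type := SQ × Fin 2 × Fin 6

/-- The head-step function of the decorated SMART machine: it acts as SMART on the
`Q̊`-component and carries the duck and ghost unchanged. -/
def decStep : HeadStep DQ Letter := fun q a =>
  match smartStep q.1 a with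
  | Sum.inl (q', b) => Sum.inl ((q', q.2), b)
  | Sum.inr (d, q') => Sum.inr (d, (q', q.2))

/-! ### The accelerated SMART dynamics

A matching transition is always followed by a move, so we merge the two into one step and
describe the state by its filling and its direction. -/

namespace Smart

/-- A configuration of the accelerated machine, about to read the letter under the head. -/
@[ext]
structure Cfg : Type where
  /-- Whether the arrow is hollow. -/
  hollow : Bool
  /-- The direction of the arrow. -/
  dir : ℤˣ
  /-- The head position. -/
  pos : ℤ
  /-- The tape content. -/
  tape : ℤ → Letter

/-- One accelerated step: rewrite the letter under the head and move. -/
def step : Cfg → Cfg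
  | ⟨false, σ, p, w⟩ =>
    if w p = 0 then ⟨false, -σ, p - σ, Function.update w p 1⟩ else ⟨true, -σ, p - σ, w⟩
  | ⟨true, σ, p, w⟩ =>
    if w p = 0 then ⟨false, σ, p + σ, Function.update w p 2⟩
    else if w p = 1 then ⟨false, σ, p + σ, Function.update w p 0⟩
    else ⟨true, -σ, p - σ, Function.update w p 0⟩

lemma step_filled_zero {σ : ℤˣ} {p : ℤ} {w : ℤ → Letter} (h : w p = 0) :
    step ⟨false, σ, p, w⟩ = ⟨false, -σ, p - σ, Function.update w p 1⟩ := by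
  simp [step, h]

lemma step_filled_ne {σ : ℤˣ} {p : ℤ} {w : ℤ → Letter} (h : w p ≠ 0) :
    step ⟨false, σ, p, w⟩ = ⟨true, -σ, p - σ, w⟩ := by
  simp [step, h]

lemma step_hollow_zero {σ : ℤˣ} {p : ℤ} {w : ℤ → Letter} (h : w p = 0) :
    step ⟨true, σ, p, w⟩ = ⟨false, σ, p + σ, Function.update w p 2⟩ := by
  simp [step, h]

lemma step_hollow_one {σ : ℤˣ} {p : ℤ} {w : ℤ → Letter} (h : w p = 1) :
    step ⟨true, σ, p, w⟩ = ⟨false, σ, p + σ, Function.update w p 0⟩ := by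
  simp [step, h]

lemma step_hollow_two {σ : ℤˣ} {p : ℤ} {w : ℤ → Letter} (h : w p = 2) :
    step ⟨true, σ, p, w⟩ = ⟨true, -σ, p - σ, Function.update w p 0⟩ := by
  simp [step, h]

lemma abs_unit (σ : ℤˣ) : |(σ : ℤ)| = 1 := by
  rcases Int.units_eq_one_or σ with rfl | rfl <;> simp

lemma abs_step_pos_sub (c : Cfg) : |(step c).pos - c.pos| ≤ 1 := by
  obtain ⟨h, σ, p, w⟩ := c
  have := abs_unit σ
  cases h <;> simp only [step] <;> split_ifs <;> simp [this]

lemma abs_iterate_pos_sub (c : Cfg) (t : ℕ) : |(step^[t] c).pos - c.pos| ≤ t := by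
  induction t with
  | zero => simp
  | succ t ih =>
    rw [Function.iterate_succ_apply']
    have := abs_step_pos_sub (step^[t] c)
    have := abs_sub_le (step (step^[t] c)).pos (step^[t] c).pos c.pos
    push_cast
    linarith

/-- The cells `p + σ * i` for `a ≤ i ≤ b`. -/
def segment (p : ℤ) (σ : ℤˣ) (a b : ℤ) : Set ℤ :=
  {q | ∃ i, a ≤ i ∧ i ≤ b ∧ q = p + σ * i}

lemma mem_segment {p : ℤ} {σ : ℤˣ} {a b : ℤ} (i : ℤ) {q : ℤ} (h₁ : a ≤ i) (h₂ : i ≤ b)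
    (h : q = p + σ * i) : q ∈ segment p σ a b := ⟨i, h₁, h₂, h⟩

lemma segment_subset {p p' : ℤ} {σ : ℤˣ} {a b a' b' : ℤ} (m : ℤ) (hp : p' = p + σ * m)
    (ha : a ≤ m + a') (hb : m + b' ≤ b) : segment p' σ a' b' ⊆ segment p σ a b := by
  rintro q ⟨i, h₁, h₂, rfl⟩
  exact ⟨m + i, by lia, by lia, by rw [hp]; ring⟩

lemma segment_neg_subset {p p' : ℤ} {σ : ℤˣ} {a b a' b' : ℤ} (m : ℤ) (hp : p' = p + σ * m)
    (ha : a ≤ m - b') (hb : m - a' ≤ b) : segment p' (-σ) a' b' ⊆ segment p σ a b := by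
  rintro q ⟨i, h₁, h₂, rfl⟩
  exact ⟨m - i, by lia, by lia, by rw [hp]; push_cast; ring⟩

lemma abs_sub_le_of_mem_segment {p q : ℤ} {σ : ℤˣ} {a b M : ℤ} (h : q ∈ segment p σ a b)
    (ha : -M ≤ a) (hb : b ≤ M) : |q - p| ≤ M := by
  obtain ⟨i, h₁, h₂, rfl⟩ := h
  rw [add_sub_cancel_left, abs_mul, abs_unit, one_mul, abs_le]
  constructor <;> lia

lemma add_mul_ne {p : ℤ} (σ : ℤˣ) {i : ℤ} (hi : i ≠ 0) : p + σ * i ≠ p := by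
  rcases Int.units_eq_one_or σ with rfl | rfl <;> simp [hi]

lemma sub_mul_ne {p : ℤ} (σ : ℤˣ) {i : ℤ} (hi : i ≠ 0) : p - σ * i ≠ p := by
  rcases Int.units_eq_one_or σ with rfl | rfl <;> simp [hi]

lemma eq_one_or_eq_two {a : Letter} (ha : a ≠ 0) : a = 1 ∨ a = 2 := by
  fin_cases a <;> simp_all

/-- The machine goes from `c` to `d` in `t` steps with the head staying in `S`. -/
def Run (S : Set ℤ) (t : ℕ) (c d : Cfg) : Prop :=
  step^[t] c = d ∧ ∀ s ≤ t, (step^[s] c).pos ∈ S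

lemma Run.refl {S : Set ℤ} {c : Cfg} (h : c.pos ∈ S) : Run S 0 c c :=
  ⟨rfl, fun s hs => by obtain rfl : s = 0 := by lia
                       exact h⟩

lemma Run.mono {S S' : Set ℤ} {t : ℕ} {c d : Cfg} (h : Run S t c d) (hS : S ⊆ S') :
    Run S' t c d := ⟨h.1, fun s hs => hS (h.2 s hs)⟩

lemma Run.trans {S : Set ℤ} {t u : ℕ} {c d e : Cfg} (h : Run S t c d) (h' : Run S u d e) :
    Run S (t + u) c e := by
  have key (s : ℕ) : step^[t + s] c = step^[s] d := by
    rw [add_comm, Function.iterate_add_apply, h.1]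
  refine ⟨(key u).trans h'.1, fun s hs => ?_⟩
  rcases le_total s t with hst | hst
  · exact h.2 s hst
  · obtain ⟨v, rfl⟩ := Nat.exists_eq_add_of_le hst
    rw [key]
    exact h'.2 v (by lia)

lemma Run.head {S : Set ℤ} {t : ℕ} {c d e : Cfg} (hc : c.pos ∈ S) (h : step c = d)
    (h' : Run S t d e) : Run S (1 + t) c e := by
  refine Run.trans ⟨h, fun s hs => ?_⟩ h'
  interval_cases s
  · exact hc
  · simpa [h] using h'.2 0 (Nat.zero_le _)

/-- A filled arrow with a nonzero letter behind it crosses `k` zeros in at least `2 ^ k - 1`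
steps, leaving the tape unchanged. -/
def FilledCrosses (k : ℕ) : Prop :=
  ∀ (σ : ℤˣ) (p : ℤ) (w : ℤ → Letter), w (p - σ) ≠ 0 →
    (∀ i : ℤ, 0 ≤ i → i < k → w (p + σ * i) = 0) →
    ∃ t, 2 ^ k ≤ t + 1 ∧ Run (segment p σ (-1) k) t ⟨false, σ, p, w⟩ ⟨false, σ, p + σ * k, w⟩

/-- A hollow arrow crosses `k` zeros followed by a nonzero letter, leaving the tape unchanged. -/
def HollowCrosses (k : ℕ) : Prop :=
  ∀ (σ : ℤˣ) (p : ℤ) (w : ℤ → Letter), w (p + σ * k) ≠ 0 →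
    (∀ i : ℤ, 0 ≤ i → i < k → w (p + σ * i) = 0) →
    ∃ t, Run (segment p σ 0 k) t ⟨true, σ, p, w⟩ ⟨true, σ, p + σ * k, w⟩

/-- A filled arrow on a zero, with `k` zeros and then a nonzero letter behind it, advances by
one cell in at least `2 ^ k + 1` steps, leaving the tape unchanged. -/
def FilledAdvances (k : ℕ) : Prop :=
  ∀ (σ : ℤˣ) (p : ℤ) (w : ℤ → Letter), w (p - σ * (k + 1)) ≠ 0 →
    (∀ i : ℤ, 0 ≤ i → i ≤ k → w (p - σ * i) = 0) →
    ∃ t, 2 ^ k ≤ t ∧ Run (segment p σ (-(k + 1)) 1) t ⟨false, σ, p, w⟩ ⟨false, σ, p + σ, w⟩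

lemma FilledCrosses.filledAdvances {k : ℕ} (hC : FilledCrosses k) (hR : HollowCrosses k) :
    FilledAdvances k := by
  intro σ p w hs hz
  have hp : w p = 0 := by simpa using hz 0 le_rfl (by lia)
  set v := Function.update w p 1 with hv
  have hvw (i : ℤ) (hi : i ≠ 0) : v (p - σ * i) = w (p - σ * i) := by
    simp [hv, sub_mul_ne σ hi]
  obtain ⟨t, ht, hrun⟩ := hC (-σ) (p - σ) v (by simp [hv]) (fun i h₁ h₂ => by
    have : p - σ + ((-σ : ℤˣ) : ℤ) * i = p - σ * (i + 1) := by push_cast; ring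
    rw [this, hvw _ (by lia), hz _ (by lia) (by lia)])
  obtain ⟨u, hrun'⟩ := hR σ (p - σ * k) v (by simp [hv]) (fun i h₁ h₂ => by
    have : p - σ * k + σ * i = p - σ * (k - i) := by ring
    rw [this, hvw _ (by lia), hz _ (by lia) (by lia)])
  refine ⟨1 + (t + (1 + (u + (1 + 0)))), by lia, ?_⟩
  refine Run.head (mem_segment 0 (by lia) (by lia) (by simp)) (step_filled_zero hp) ?_
  refine (hrun.mono (segment_neg_subset (-1) (by ring) (by lia) (by lia))).trans ?_
  have e₁ : p - σ + ((-σ : ℤˣ) : ℤ) * k = p - σ * (k + 1) := by push_cast; ring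
  refine Run.head (mem_segment (-(k + 1)) (by lia) (by lia) (by rw [e₁]; ring))
    (step_filled_ne (by rw [e₁, hvw _ (by lia)]; exact hs)) ?_
  have e₂ : p - σ + ((-σ : ℤˣ) : ℤ) * k - ((-σ : ℤˣ) : ℤ) = p - σ * k := by push_cast; ring
  rw [e₂, neg_neg]
  refine (hrun'.mono (segment_subset (-k) (by ring) (by lia) (by lia))).trans ?_
  rw [sub_add_cancel]
  refine Run.head (mem_segment 0 (by lia) (by lia) (by simp)) (step_hollow_one (by simp [hv])) ?_
  have e₃ : Function.update v p 0 = w := by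
    rw [hv, Function.update_idem, ← hp, Function.update_eq_self]
  rw [e₃]
  exact Run.refl (mem_segment 1 (by lia) (by lia) (by simp))

lemma FilledCrosses.succ {k : ℕ} (hC : FilledCrosses k) (hB : FilledAdvances k) :
    FilledCrosses (k + 1) := by
  intro σ p w hs hz
  obtain ⟨t, ht, hrun⟩ := hC σ p w hs (fun i h₁ h₂ => hz i h₁ (by push_cast; lia))
  obtain ⟨u, hu, hrun'⟩ := hB σ (p + σ * k) w
    (by convert hs using 2; ring)
    (fun i h₁ h₂ => by
      have : p + σ * k - σ * i = p + σ * (k - i) := by ring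
      rw [this]
      exact hz _ (by lia) (by push_cast; lia))
  refine ⟨t + u, by rw [pow_succ]; lia, ?_⟩
  have e : p + σ * ((k + 1 : ℕ) : ℤ) = p + σ * k + σ := by push_cast; ring
  rw [e]
  exact (hrun.mono (segment_subset 0 (by ring) (by lia) (by push_cast; lia))).trans
    (hrun'.mono (segment_subset k rfl (by lia) (by push_cast; lia)))

lemma HollowCrosses.succ {k : ℕ} (hC : FilledCrosses k) (hR : HollowCrosses k) :
    HollowCrosses (k + 1) := by
  intro σ p w hs hz
  push_cast at hs hz ⊢
  have hp : w p = 0 := by simpa using hz 0 le_rfl (by lia)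
  set v := Function.update w p 2 with hv
  have hvw (i : ℤ) (hi : i ≠ 0) : v (p + σ * i) = w (p + σ * i) := by
    simp [hv, add_mul_ne σ hi]
  have hvp : v p = 2 := by simp [hv]
  obtain ⟨t, -, hrun⟩ := hC σ (p + σ) v (by simp [hvp]) (fun i h₁ h₂ => by
    have : p + σ + σ * i = p + σ * (i + 1) := by ring
    rw [this, hvw _ (by lia), hz _ (by lia) (by lia)])
  have e₁ : p + σ * k + ((-σ : ℤˣ) : ℤ) * k = p := by push_cast; ring
  obtain ⟨u, hrun'⟩ := hR (-σ) (p + σ * k) v (by rw [e₁, hvp]; decide) (fun i h₁ h₂ => by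
    have : p + σ * k + ((-σ : ℤˣ) : ℤ) * i = p + σ * (k - i) := by push_cast; ring
    rw [this, hvw _ (by lia), hz _ (by lia) (by lia)])
  have e₂ : p + σ + σ * k = p + σ * (k + 1) := by ring
  obtain ⟨s, hrun''⟩ := hR σ (p + σ) w (by rwa [e₂]) (fun i h₁ h₂ => by
    have : p + σ + σ * i = p + σ * (i + 1) := by ring
    rw [this, hz _ (by lia) (by lia)])
  rw [e₁] at hrun'
  rw [e₂] at hrun hrun''
  refine ⟨1 + (t + (1 + (u + (1 + s)))), ?_⟩
  refine Run.head (mem_segment 0 (by lia) (by lia) (by simp)) (step_hollow_zero hp) ?_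
  refine (hrun.mono (segment_subset 1 (by ring) (by lia) (by lia))).trans ?_
  refine Run.head (mem_segment (k + 1) (by lia) (by lia) rfl)
    (step_filled_ne (by rw [hvw _ (by lia)]; exact hs)) ?_
  have e₃ : p + σ * (k + 1) - σ = p + σ * (k : ℤ) := by ring
  rw [e₃]
  refine (hrun'.mono (segment_neg_subset k rfl (by lia) (by lia))).trans ?_
  refine Run.head (mem_segment 0 (by lia) (by lia) (by simp)) (step_hollow_two hvp) ?_
  have e₄ : Function.update v p 0 = w := by
    rw [hv, Function.update_idem, ← hp, Function.update_eq_self]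
  have e₅ : p - ((-σ : ℤˣ) : ℤ) = p + σ := by push_cast; ring
  rw [e₄, e₅, neg_neg]
  exact hrun''.mono (segment_subset 1 (by ring) (by lia) (by lia))

lemma filledCrosses_and_hollowCrosses (k : ℕ) : FilledCrosses k ∧ HollowCrosses k := by
  induction k with
  | zero =>
    refine ⟨fun σ p w _ _ => ⟨0, by simp, ?_⟩, fun σ p w _ _ => ⟨0, ?_⟩⟩ <;>
    · simp only [Nat.cast_zero, mul_zero, add_zero]
      exact Run.refl (mem_segment 0 (by lia) (by lia) (by simp))
  | succ k ih => exact ⟨ih.1.succ (ih.1.filledAdvances ih.2), HollowCrosses.succ ih.1 ih.2⟩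

lemma filledCrosses (k : ℕ) : FilledCrosses k := (filledCrosses_and_hollowCrosses k).1

lemma hollowCrosses (k : ℕ) : HollowCrosses k := (filledCrosses_and_hollowCrosses k).2

lemma filledAdvances (k : ℕ) : FilledAdvances k := (filledCrosses k).filledAdvances (hollowCrosses k)

/-- During the first `T - 1` steps from `c`, the head stays at distance at most `M` from `o`. -/
def StaysNear (T : ℕ) (o M : ℤ) (c : Cfg) : Prop := ∀ t < T, |(step^[t] c).pos - o| ≤ M

lemma StaysNear.head {T : ℕ} {o M : ℤ} {c : Cfg} (hc : |c.pos - o| ≤ M)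
    (h : StaysNear T o M (step c)) : StaysNear (T + 1) o M c := by
  intro t ht
  cases t with
  | zero => exact hc
  | succ t => exact h t (by lia)

lemma StaysNear.mono {T T' : ℕ} {o M : ℤ} {c : Cfg} (h : StaysNear T o M c) (hT : T' ≤ T) :
    StaysNear T' o M c := fun t ht => h t (by lia)

lemma Run.staysNear {S : Set ℤ} {t T : ℕ} {o M : ℤ} {c d : Cfg} (hrun : Run S t c d)
    (hS : ∀ q ∈ S, |q - o| ≤ M) (h : StaysNear T o M d) : StaysNear (t + T) o M c := by
  intro s hs
  rcases le_total s t with hst | hst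
  · exact hS _ (hrun.2 s hst)
  · obtain ⟨v, rfl⟩ := Nat.exists_eq_add_of_le hst
    rw [add_comm, Function.iterate_add_apply, hrun.1]
    exact h v (by lia)

lemma staysNear_of_filled {N : ℕ} {σ : ℤˣ} {p o M : ℤ} {w : ℤ → Letter} (hs : w (p - σ) ≠ 0)
    (hz : ∀ i : ℤ, 0 ≤ i → i < N → w (p + σ * i) = 0) (hM : |p - o| + N + 1 ≤ M) :
    StaysNear (2 ^ N) o M ⟨false, σ, p, w⟩ := by
  obtain ⟨t, ht, hrun⟩ := filledCrosses N σ p w hs hz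
  intro s hsN
  have h₁ := abs_sub_le_of_mem_segment (M := N + 1) (hrun.2 s (by lia)) (by lia) (by lia)
  have := abs_sub_le (step^[s] ⟨false, σ, p, w⟩).pos p o
  linarith

lemma staysNear_of_hollow {N : ℕ} {σ : ℤˣ} {p o M : ℤ} {w : ℤ → Letter}
    (hz : ∀ i : ℤ, 0 ≤ i → i ≤ N → w (p + σ * i) = 0) (hM : |p - o| + N + 2 ≤ M) :
    StaysNear (2 ^ N) o M ⟨true, σ, p, w⟩ := by
  refine StaysNear.mono (StaysNear.head (T := 2 ^ N) (by dsimp only; lia) ?_) (by lia)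
  rw [step_hollow_zero (by simpa using hz 0 le_rfl (by lia))]
  refine staysNear_of_filled (by simp) (fun i h₁ h₂ => ?_) ?_
  · have e : p + σ + σ * i = p + σ * (i + 1) := by ring
    rw [e, Function.update_of_ne (add_mul_ne σ (by lia))]
    exact hz _ (by lia) (by lia)
  · have h₁ := abs_sub_le (p + σ) p o
    rw [add_sub_cancel_left, abs_unit] at h₁
    linarith

/-- With at least `N + 1` zeros behind a filled arrow, the head stays nearby for `2 ^ N` steps. -/
lemma staysNear_of_filled_zeros_behind {N : ℕ} {σ : ℤˣ} {p o M : ℤ} {w : ℤ → Letter}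
    (hz : ∀ i : ℤ, 1 ≤ i → i ≤ N + 1 → w (p - σ * i) = 0) (hM : |p - o| + N + 3 ≤ M) :
    StaysNear (2 ^ N) o M ⟨false, σ, p, w⟩ := by
  have h₁ := abs_sub_le (p - σ) p o
  have h₂ : |p - σ - p| = 1 := by
    rw [sub_sub_cancel_left, abs_neg, abs_unit]
  have e (i : ℤ) : p - σ + ((-σ : ℤˣ) : ℤ) * i = p - σ * (i + 1) := by push_cast; ring
  refine StaysNear.mono (StaysNear.head (T := 2 ^ N) (by dsimp only; lia) ?_) (by lia)
  by_cases hp : w p = 0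
  · rw [step_filled_zero hp]
    refine staysNear_of_filled (by simp) (fun i h₁ h₂ => ?_) (by lia)
    rw [e, Function.update_of_ne (sub_mul_ne σ (by lia))]
    exact hz _ (by lia) (by lia)
  · rw [step_filled_ne hp]
    refine staysNear_of_hollow (fun i h₁ h₂ => ?_) (by lia)
    rw [e]
    exact hz _ (by lia) (by lia)

/-- With at least `N + 1` zeros behind an arrow, filled or reading a nonzero letter, the head
stays nearby for `2 ^ N` steps. -/
lemma staysNear_of_zeros_behind {N : ℕ} {h : Bool} {σ : ℤˣ} {p o M : ℤ} {w : ℤ → Letter}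
    (hh : h = true → w p ≠ 0) (hz : ∀ i : ℤ, 1 ≤ i → i ≤ N + 1 → w (p - σ * i) = 0)
    (hM : |p - o| + N + 4 ≤ M) : StaysNear (2 ^ N) o M ⟨h, σ, p, w⟩ := by
  cases h with
  | false => exact staysNear_of_filled_zeros_behind hz (by lia)
  | true =>
    refine StaysNear.mono (StaysNear.head (T := 2 ^ N) (by dsimp only; lia) ?_) (by lia)
    obtain hp | hp := eq_one_or_eq_two (hh rfl)
    · rw [step_hollow_one hp]
      refine staysNear_of_filled_zeros_behind (fun i h₁ h₂ => ?_) ?_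
      · have e : p + σ - σ * i = p - σ * (i - 1) := by ring
        rw [e]
        rcases eq_or_ne i 1 with rfl | hi
        · simp
        · rw [Function.update_of_ne (sub_mul_ne σ (by lia))]
          exact hz _ (by lia) (by lia)
      · have h₁ := abs_sub_le (p + σ) p o
        rw [add_sub_cancel_left, abs_unit] at h₁
        linarith
    · rw [step_hollow_two hp]
      refine staysNear_of_hollow (fun i h₁ h₂ => ?_) ?_
      · have e : p - σ + ((-σ : ℤˣ) : ℤ) * i = p - σ * (i + 1) := by push_cast; ring
        rw [e, Function.update_of_ne (sub_mul_ne σ (by lia))]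
        exact hz _ (by lia) (by lia)
      · have h₁ := abs_sub_le (p - σ) p o
        rw [sub_sub_cancel_left, abs_neg, abs_unit] at h₁
        linarith

lemma exists_ne_zero_or_forall_eq_zero (f : ℤ → Letter) (N : ℕ) :
    (∃ k ≤ N, f (k + 1) ≠ 0 ∧ ∀ i : ℤ, 1 ≤ i → i ≤ k → f i = 0) ∨
      ∀ i : ℤ, 1 ≤ i → i ≤ N + 1 → f i = 0 := by
  classical
  by_cases h : ∃ k : ℕ, k ≤ N ∧ f (k + 1) ≠ 0
  · refine Or.inl ⟨Nat.find h, (Nat.find_spec h).1, (Nat.find_spec h).2, fun i h₁ h₂ => ?_⟩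
    have := Nat.find_min h (m := (i - 1).toNat) (by lia)
    have hle := (Nat.find_spec h).1
    by_contra hi
    refine this ⟨by lia, ?_⟩
    rwa [Int.toNat_of_nonneg (by lia), sub_add_cancel]
  · push Not at h
    refine Or.inr fun i h₁ h₂ => ?_
    have := h (i - 1).toNat (by lia)
    rwa [Int.toNat_of_nonneg (by lia), sub_add_cancel] at this

set_option maxHeartbeats 400000 in
/-- The invariant behind the movement bound: between the head and the reference cell
`o = p - σ * j` lie only zeros. -/
lemma staysNear_of_zeros_between {N T : ℕ} (hT : T ≤ 2 ^ N) {h : Bool} {σ : ℤˣ} {p o j : ℤ}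
    {w : ℤ → Letter} (hh : h = true → w p ≠ 0) (hj : 0 ≤ j) (hjN : j ≤ N + 2)
    (ho : o = p - σ * j) (hz : ∀ i : ℤ, 1 ≤ i → i < j → w (p - σ * i) = 0) :
    StaysNear T o (2 * N + 6) ⟨h, σ, p, w⟩ := by
  induction T using Nat.strong_induction_on generalizing h σ p j w with
  | _ T ih =>
  have hpo : |p - o| = j := by
    rw [ho, sub_sub_cancel, abs_mul, abs_unit, one_mul, abs_of_nonneg hj]
  rcases exists_ne_zero_or_forall_eq_zero (fun i => w (p - σ * i)) N with
    ⟨k, hkN, hk, hkz⟩ | hbig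
  · have hjk : j ≤ k + 1 := by
      by_contra! hlt
      exact hk (hz _ (by lia) hlt)
    rcases Nat.eq_zero_or_pos T with rfl | hTpos
    · intro t ht
      lia
    have hnear (q : ℤ) (hq : q ∈ segment p σ (-(k + 1)) 1) : |q - o| ≤ 2 * N + 6 := by
      have h₁ := abs_sub_le_of_mem_segment (M := k + 1) hq (by lia) (by lia)
      have h₂ := abs_sub_le q p o
      lia
    have hp_mem : p ∈ segment p σ (-(k + 1)) 1 := mem_segment 0 (by lia) (by lia) (by simp)
    -- In each case some run of positive length leads back to the invariant.
    have conclude {t : ℕ} (ht : 1 ≤ t) {d : Cfg}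
        (hrun : Run (segment p σ (-(k + 1)) 1) t ⟨h, σ, p, w⟩ d)
        (hd : StaysNear (T - t) o (2 * N + 6) d) :
        StaysNear T o (2 * N + 6) ⟨h, σ, p, w⟩ :=
      (hrun.staysNear hnear hd).mono (by lia)
    -- The hollow arrow turning back from `p` crosses the `k` zeros.
    have turn (v : ℤ → Letter) (hv : ∀ i : ℤ, i ≠ 0 → v (p - σ * i) = w (p - σ * i))
        (hstep : step ⟨h, σ, p, w⟩ = ⟨true, -σ, p - σ, v⟩) :
        StaysNear T o (2 * N + 6) ⟨h, σ, p, w⟩ := by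
      have e (i : ℤ) : p - σ + ((-σ : ℤˣ) : ℤ) * i = p - σ * (i + 1) := by push_cast; ring
      obtain ⟨t, hrun⟩ := hollowCrosses k (-σ) (p - σ) v
        (by rw [e, hv _ (by lia)]; exact hk)
        (fun i h₁ h₂ => by rw [e, hv _ (by lia)]; exact hkz _ (by lia) (by lia))
      refine conclude (t := 1 + t) (by lia) (Run.head hp_mem hstep
        (hrun.mono (segment_neg_subset (-1) (by ring) (by lia) (by lia)))) ?_
      rw [e]
      refine ih (T - (1 + t)) (by lia) (by lia) (j := k + 1 - j)
        (fun _ => by rw [hv _ (by lia)]; exact hk) (by lia) (by lia) ?_ (fun i h₁ h₂ => ?_)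
      · rw [ho]; push_cast; ring
      · have e' : p - σ * (k + 1) - ((-σ : ℤˣ) : ℤ) * i = p - σ * (k + 1 - i) := by
          push_cast; ring
        rw [e', hv _ (by lia)]
        exact hkz _ (by lia) (by lia)
    have e (i : ℤ) : p + σ - σ * i = p - σ * (i - 1) := by ring
    cases h with
    | false =>
      by_cases hp : w p = 0
      · obtain ⟨t, ht, hrun⟩ := filledAdvances k σ p w hk (fun i h₁ h₂ => by
          rcases eq_or_ne i 0 with rfl | hi
          · simpa using hp
          · exact hkz i (by lia) h₂)
        have hpos : 1 ≤ t := Nat.one_le_two_pow.trans ht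
        refine conclude hpos hrun (ih _ (by lia) (by lia) (j := j + 1) (by simp) (by lia)
          (by lia) (by rw [ho]; ring) (fun i h₁ h₂ => ?_))
        rw [e]
        rcases eq_or_ne i 1 with rfl | hi
        · simpa using hp
        · exact hz _ (by lia) (by lia)
      · exact turn w (fun _ _ => rfl) (step_filled_ne hp)
    | true =>
      obtain hp | hp := eq_one_or_eq_two (hh rfl)
      · refine conclude (t := 1 + 0) le_rfl (Run.head hp_mem (step_hollow_one hp)
          (Run.refl (mem_segment 1 (by lia) (by lia) (by simp))))
          (ih _ (by lia) (by lia) (j := j + 1) (by simp) (by lia)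
            (by lia) (by rw [ho]; ring) (fun i h₁ h₂ => ?_))
        rw [e]
        rcases eq_or_ne i 1 with rfl | hi
        · simp
        · rw [Function.update_of_ne (sub_mul_ne σ (by lia))]
          exact hz _ (by lia) (by lia)
      · exact turn _ (fun i hi => Function.update_of_ne (sub_mul_ne σ hi) _ _) (step_hollow_two hp)
  · exact (staysNear_of_zeros_behind hh hbig (by lia)).mono hT

/-- In fewer than `2 ^ N` steps the head moves by at most `2 * N + 7` cells. -/
lemma abs_iterate_pos_sub_le_of_lt_two_pow (c : Cfg) {N t : ℕ} (ht : t < 2 ^ N) :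
    |(step^[t] c).pos - c.pos| ≤ 2 * N + 7 := by
  have key {h : Bool} {σ : ℤˣ} {p : ℤ} {w : ℤ → Letter} (hh : h = true → w p ≠ 0) {s : ℕ}
      (hs : s < 2 ^ N) : |(step^[s] ⟨h, σ, p, w⟩).pos - p| ≤ 2 * N + 6 :=
    staysNear_of_zeros_between le_rfl (j := 0) hh le_rfl (by lia) (by simp)
      (fun i h₁ h₂ => by lia) s hs
  obtain ⟨h, σ, p, w⟩ := c
  by_cases hh : h = true → w p ≠ 0
  · have := key (σ := σ) hh ht
    dsimp only
    lia
  · push Not at hh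
    obtain ⟨rfl, hp⟩ := hh
    cases t with
    | zero => simp; lia
    | succ t =>
      rw [Function.iterate_succ_apply, step_hollow_zero hp]
      have h₁ := key (h := false) (σ := σ) (p := p + σ) (w := Function.update w p 2) (by simp)
        (Nat.lt_of_succ_lt ht)
      have h₂ := abs_sub_le
        (step^[t] ⟨false, σ, p + σ, Function.update w p 2⟩).pos (p + σ) p
      rw [add_sub_cancel_left, abs_unit] at h₂
      dsimp only
      linarith

/-! ### Comparison with the moving-head action -/

section Place

variable {Q Γ : Type}

/-- The tape `w` with a head in state `q` at position `p`. -/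
def place (q : Q) (p : ℤ) (w : ℤ → Γ) : ℤ → TSym Q Γ :=
  fun i => if i = p then Sum.inr (q, w i) else Sum.inl (w i)

lemma isRight_place {q : Q} {p : ℤ} {w : ℤ → Γ} {i : ℤ} :
    (place q p w i).isRight = true ↔ i = p := by
  unfold place
  split_ifs with h <;> simp [h]

lemma atMostOneHeadZ_place (q : Q) (p : ℤ) (w : ℤ → Γ) : AtMostOneHeadZ (place q p w) :=
  fun _ _ hi hj => (isRight_place.1 hi).trans (isRight_place.1 hj).symm

lemma exists_eq_place {x : ℤ → TSym Q Γ} (hx : AtMostOneHeadZ x) {p : ℤ}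
    (hp : (x p).isRight = true) : ∃ q w, x = place q p w := by
  obtain ⟨⟨q, a⟩, hqa⟩ := Sum.isRight_iff.1 hp
  refine ⟨q, fun i => tapeLetter (x i), funext fun i => ?_⟩
  unfold place
  split_ifs with h
  · simp [h, hqa, tapeLetter]
  · have hi : ¬ (x i).isRight = true := fun hi => h (hx i p hi hp)
    rcases hxi : x i with b | b
    · simp [hxi, tapeLetter]
    · simp [hxi] at hi

lemma stepZ_eq_self {δ : HeadStep Q Γ} {x : ℤ → TSym Q Γ} (hx : ∀ i, (x i).isRight = false) :
    stepZ δ x = x := by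
  have (i : ℤ) : ∃ a, x i = Sum.inl a := Sum.isLeft_iff.1 (by simpa using hx i)
  choose f hf using this
  funext i
  simp [stepZ, localStep, arrivesAs, hf]

lemma stepZ_place_of_match {δ : HeadStep Q Γ} {q q' : Q} {p : ℤ} {w : ℤ → Γ} {b : Γ}
    (h : δ q (w p) = Sum.inl (q', b)) :
    stepZ δ (place q p w) = place q' p (Function.update w p b) := by
  funext i
  by_cases hi : i = p
  · subst hi
    simp [stepZ, place, localStep, h]
  · by_cases h₁ : i - 1 = p <;> by_cases h₂ : i + 1 = p <;>
      simp [stepZ, place, localStep, arrivesAs, hi, h₁, h₂, h]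

lemma stepZ_place_of_move {δ : HeadStep Q Γ} {q q' : Q} {p : ℤ} {w : ℤ → Γ} {σ : ℤˣ}
    (h : δ q (w p) = Sum.inr ((σ : ℤ), q')) :
    stepZ δ (place q p w) = place q' (p + σ) w := by
  funext i
  have hσ := Int.units_eq_one_or σ
  by_cases hi : i = p
  · subst hi
    simp [stepZ, place, localStep, h]
  · rcases eq_or_ne (i - 1) p with h₁ | h₁
    · have h₂ : i + 1 ≠ p := by lia
      have h₃ : i = p + 1 := by lia
      rcases hσ with rfl | rfl <;>
        simp_all [stepZ, place, localStep, arrivesAs]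
    · rcases eq_or_ne (i + 1) p with h₂ | h₂
      · have h₃ : i = p - 1 := by lia
        rcases hσ with rfl | rfl <;>
          simp_all [stepZ, place, localStep, arrivesAs, sub_eq_add_neg]
      · rcases hσ with rfl | rfl
        · have h₃ : i ≠ p + 1 := by lia
          simp_all [stepZ, place, localStep, arrivesAs]
        · have h₃ : i ≠ p + -1 := by lia
          simp_all [stepZ, place, localStep, arrivesAs]

end Place

/-- The arrow with given filling and direction. -/
def arrow (h : Bool) (σ : ℤˣ) : Arrow :=
  if σ = 1 then (if h then .rh else .rf) else (if h then .lh else .lf)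

lemma exists_eq_arrow (A : Arrow) : ∃ h σ, A = arrow h σ := by
  cases A
  · exact ⟨false, 1, by simp [arrow]⟩
  · exact ⟨false, -1, by simp [arrow]⟩
  · exact ⟨true, 1, by simp [arrow]⟩
  · exact ⟨true, -1, by simp [arrow]⟩

/-- The configuration of the decorated machine, in a matching state with decoration `g`, that
corresponds to `c`. -/
def Cfg.toTape (g : Fin 2 × Fin 6) (c : Cfg) : ℤ → TSym DQ Letter :=
  place ((arrow c.hollow c.dir, 0), g) c.pos c.tape

lemma stepZ_place_move (g : Fin 2 × Fin 6) (h : Bool) (σ : ℤˣ) (p : ℤ) (w : ℤ → Letter) :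
    stepZ decStep (place ((arrow h σ, 1), g) p w) = Cfg.toTape g ⟨h, σ, p + σ, w⟩ := by
  refine stepZ_place_of_move ?_
  rcases Int.units_eq_one_or σ with rfl | rfl <;> cases h <;> simp [decStep, smartStep, arrow]

lemma stepZ_toTape (g : Fin 2 × Fin 6) (c : Cfg) : ∃ h σ w,
    stepZ decStep (c.toTape g) = place ((arrow h σ, 1), g) c.pos w ∧
      step c = ⟨h, σ, c.pos + σ, w⟩ := by
  obtain ⟨h, σ, p, w⟩ := c
  have key {h' : Bool} {σ' : ℤˣ} {b : Letter}
      (hs : smartStep (arrow h σ, 0) (w p) = Sum.inl ((arrow h' σ', 1), b))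
      (hstep : step ⟨h, σ, p, w⟩ = ⟨h', σ', p + σ', Function.update w p b⟩) :
      ∃ h' σ' w', stepZ decStep (Cfg.toTape g ⟨h, σ, p, w⟩) = place ((arrow h' σ', 1), g) p w' ∧
        step ⟨h, σ, p, w⟩ = ⟨h', σ', p + σ', w'⟩ :=
    ⟨h', σ', _, stepZ_place_of_match (by simp [decStep, hs]), hstep⟩
  by_cases hp : w p = 0
  · cases h with
    | false =>
      refine key (h' := false) (σ' := -σ) (b := 1) ?_
        (by rw [step_filled_zero hp, Units.val_neg, sub_eq_add_neg])
      rcases Int.units_eq_one_or σ with rfl | rfl <;> simp [smartStep, arrow, hp]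
    | true =>
      refine key (h' := false) (σ' := σ) (b := 2) ?_ (step_hollow_zero hp)
      rcases Int.units_eq_one_or σ with rfl | rfl <;> simp [smartStep, arrow, hp]
  · cases h with
    | false =>
      refine key (h' := true) (σ' := -σ) (b := w p) ?_
        (by rw [step_filled_ne hp, Function.update_eq_self, Units.val_neg, sub_eq_add_neg])
      rcases eq_one_or_eq_two hp with hp | hp <;>
        rcases Int.units_eq_one_or σ with rfl | rfl <;> simp [smartStep, arrow, hp]
    | true =>
      rcases eq_one_or_eq_two hp with hp | hp
      · refine key (h' := false) (σ' := σ) (b := 0) ?_ (step_hollow_one hp)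
        rcases Int.units_eq_one_or σ with rfl | rfl <;> simp [smartStep, arrow, hp]
      · refine key (h' := true) (σ' := -σ) (b := 0) ?_
          (by rw [step_hollow_two hp, Units.val_neg, sub_eq_add_neg])
        rcases Int.units_eq_one_or σ with rfl | rfl <;> simp [smartStep, arrow, hp]

lemma stepZ_stepZ_toTape (g : Fin 2 × Fin 6) (c : Cfg) :
    stepZ decStep (stepZ decStep (c.toTape g)) = (step c).toTape g := by
  obtain ⟨h, σ, w, h₁, h₂⟩ := stepZ_toTape g c
  rw [h₁, stepZ_place_move, h₂]

lemma iterate_two_mul_toTape (g : Fin 2 × Fin 6) (c : Cfg) (t : ℕ) :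
    (stepZ decStep)^[2 * t] (c.toTape g) = (step^[t] c).toTape g := by
  rw [Function.iterate_mul]
  exact ((Function.Semiconj.iterate_right (f := Cfg.toTape g) (ga := step)
    (gb := (stepZ decStep)^[2]) (fun c => (stepZ_stepZ_toTape g c).symm) t) c).symm

/-- The head position of the decorated machine in terms of the accelerated machine. -/
lemma isRight_iterate_toTape {g : Fin 2 × Fin 6} {c : Cfg} {t : ℕ} {i : ℤ} :
    ((stepZ decStep)^[t] (c.toTape g) i).isRight = true ↔ i = (step^[t / 2] c).pos := by
  rcases Nat.even_or_odd' t with ⟨s, rfl | rfl⟩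
  · rw [iterate_two_mul_toTape, Cfg.toTape, isRight_place, Nat.mul_div_cancel_left _ two_pos]
  · rw [Function.iterate_succ_apply', iterate_two_mul_toTape]
    obtain ⟨h, σ, w, h₁, -⟩ := stepZ_toTape g (step^[s] c)
    rw [h₁, isRight_place, show (2 * s + 1) / 2 = s by lia]

/-- In fewer than `2 ^ N` steps the head of the decorated machine moves by at most `2 * N + 8`
cells. -/
lemma abs_sub_le_of_isRight_iterate {x : ℤ → TSym DQ Letter} (hx : AtMostOneHeadZ x) {p i : ℤ}
    (hp : (x p).isRight = true) {N t : ℕ} (ht : t < 2 ^ N)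
    (hi : ((stepZ decStep)^[t] x i).isRight = true) : |i - p| ≤ 2 * N + 8 := by
  obtain ⟨⟨⟨A, s⟩, g⟩, w, rfl⟩ := exists_eq_place hx hp
  obtain ⟨h, σ, rfl⟩ := exists_eq_arrow A
  have hs : s = 0 ∨ s = 1 := by fin_cases s <;> simp
  rcases hs with rfl | rfl
  · obtain rfl := (isRight_iterate_toTape (g := g) (c := ⟨h, σ, p, w⟩)).1 hi
    have := abs_iterate_pos_sub_le_of_lt_two_pow ⟨h, σ, p, w⟩ (N := N) (t := t / 2) (by lia)
    dsimp only at this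
    lia
  · cases t with
    | zero =>
      obtain rfl := isRight_place.1 hi
      simp
      lia
    | succ t =>
      rw [Function.iterate_succ_apply, stepZ_place_move, isRight_iterate_toTape] at hi
      subst hi
      have h₁ := abs_iterate_pos_sub_le_of_lt_two_pow ⟨h, σ, p + σ, w⟩ (N := N) (t := t / 2)
        (by lia)
      have h₂ := abs_sub_le (step^[t / 2] ⟨h, σ, p + σ, w⟩).pos (p + σ) p
      rw [add_sub_cancel_left, abs_unit] at h₂
      dsimp only at h₁
      linarith

lemma exists_iterate_ne {n : ℕ} (hn : 1 ≤ n) :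
    ∃ x : ℤ → TSym DQ Letter, AtMostOneHeadZ x ∧ (stepZ decStep)^[n] x ≠ x := by
  set w : ℤ → Letter := fun i => if i < 0 then 1 else 0 with hw
  set c : Cfg := ⟨false, 1, 0, w⟩ with hc
  refine ⟨c.toTape 0, atMostOneHeadZ_place _ _ _, fun hper => ?_⟩
  obtain ⟨t, -, ht, -⟩ := filledCrosses (n + 1) 1 0 w (by simp [hw])
    (fun i h₁ h₂ => by simp [hw, h₁])
  have hmod := Function.IsPeriodicPt.iterate_mod_apply (f := stepZ decStep) (n := n) hper (2 * t)
  have hpos : ((stepZ decStep)^[2 * t] (c.toTape 0) (n + 1)).isRight = true := by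
    rw [iterate_two_mul_toTape, ht, Cfg.toTape, isRight_place]
    simp
  rw [← hmod, isRight_iterate_toTape] at hpos
  have h₁ := abs_iterate_pos_sub c (2 * t % n / 2)
  have h₂ := Nat.mod_lt (2 * t) hn
  rw [← hpos, hc] at h₁
  dsimp only at h₁
  rw [sub_zero, abs_of_nonneg (by lia)] at h₁
  lia

lemma card_visited_le {n : ℕ} {x : ℤ → TSym DQ Letter} (hx : AtMostOneHeadZ x)
    {l r : ℤ} (hlr : ∀ i : ℤ, l ≤ i → i ≤ r → ∃ t : ℕ, t ≤ n ∧
      (((stepZ decStep)^[t] x) i).isRight = true) :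
    ((r - l + 1 : ℤ) : ℝ) ≤ 4 * Real.logb 2 n + 21 := by
  have hlog : (Nat.log 2 n : ℝ) ≤ Real.logb 2 n := by exact_mod_cast Real.natLog_le_logb n 2
  have hlog₀ : (0 : ℝ) ≤ Nat.log 2 n := by positivity
  rcases lt_or_ge r l with hrl | hrl
  · have : ((r - l + 1 : ℤ) : ℝ) ≤ 0 := by exact_mod_cast (by lia : r - l + 1 ≤ 0)
    linarith
  · obtain ⟨p, hp⟩ : ∃ p, (x p).isRight = true := by
      by_contra! hno
      obtain ⟨t, -, ht⟩ := hlr l le_rfl hrl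
      rw [Function.iterate_fixed (stepZ_eq_self fun i => by simpa using hno i)] at ht
      exact hno l ht
    have hbound (i : ℤ) (h₁ : l ≤ i) (h₂ : i ≤ r) : |i - p| ≤ 2 * (Nat.log 2 n + 1 : ℕ) + 8 := by
      obtain ⟨t, htn, ht⟩ := hlr i h₁ h₂
      exact abs_sub_le_of_isRight_iterate hx hp
        (htn.trans_lt (Nat.lt_pow_succ_log_self one_lt_two n)) ht
    have h₁ := abs_le.1 (hbound l le_rfl hrl)
    have h₂ := abs_le.1 (hbound r hrl le_rfl)
    have h₃ : r - l + 1 ≤ 4 * (Nat.log 2 n : ℤ) + 21 := by push_cast at h₁ h₂; linarith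
    have h₄ : ((r - l + 1 : ℤ) : ℝ) ≤ 4 * (Nat.log 2 n : ℝ) + 21 := by exact_mod_cast h₃
    linarith

end Smart

/-- **Lemma.** The moving-head action `T` of the decorated SMART machine has infinite order,
and its movement function satisfies `m(n) ≤ C·log₂ n + C'` for some constants `C, C' > 0`:
any interval of cells all of which are visited by the head within the first `n` steps of a
run started at a configuration with at most one head has length at most `C·log₂ n + C'`. -/
theorem decorated_smart_infinite_order_and_log_movement :
    (∀ n : ℕ, 1 ≤ n → ∃ x : ℤ → TSym DQ Letter, AtMostOneHeadZ x ∧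
      (stepZ decStep)^[n] x ≠ x) ∧
    (∃ C C' : ℝ, 0 < C ∧ 0 < C' ∧ ∀ n : ℕ, 1 ≤ n →
      ∀ x : ℤ → TSym DQ Letter, AtMostOneHeadZ x →
      ∀ l r : ℤ,
        (∀ i : ℤ, l ≤ i → i ≤ r → ∃ t : ℕ, t ≤ n ∧
          (((stepZ decStep)^[t] x) i).isRight = true) →
        ((r - l + 1 : ℤ) : ℝ) ≤ C * Real.logb 2 n + C') := by
  exact ⟨fun n hn => Smart.exists_iterate_ne hn, 4, 21, by norm_num, by norm_num,
    fun n _ x hx l r hlr => Smart.card_visited_le hx hlr⟩
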